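/- arXiv:1904.11479 — 4 statements merged into one kernel-verified Lean document; each statement's English description precedes it below -/
import Mathlib

section
/- For every a ∈ K with a + σ(a) = 1 there exist b₁, b₂ ∈ K with Δ(b₁,b₂) ≠ 0 and inv(b₁,b₂) = a. (In particular the invariant map is surjective onto the trace-one elements of K.) -/
/-- For `K/F` a degree-2 Galois extension with nontrivial Galois element `σ`:
every `a ∈ K` with `a + σ(a) = 1` is of the form `inv(b₁,b₂) = b₁·σ(b₂)/Δ(b₁,b₂)`
for some `b₁ b₂ ∈ K` with `Δ(b₁,b₂) = b₁·σ(b₂) − σ(b₁)·b₂ ≠ 0`;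
i.e. the invariant map is surjective onto the trace-one elements of `K`. -/
theorem inv_surjective_onto_trace_one
    {F K : Type*} [Field F] [Field K] [Algebra F K] [IsGalois F K]
    (hrank : Module.finrank F K = 2) (σ : K ≃ₐ[F] K) (hσ : σ ≠ AlgEquiv.refl)
    (a : K) (ha : a + σ a = 1) :
    ∃ b₁ b₂ : K, b₁ * σ b₂ - σ b₁ * b₂ ≠ 0 ∧
      b₁ * σ b₂ / (b₁ * σ b₂ - σ b₁ * b₂) = a := by
  have : FiniteDimensional F K := Module.finite_of_finrank_pos (by lia)
  have hcard : Nat.card (K ≃ₐ[F] K) = 2 := by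
    rw [IsGalois.card_aut_eq_finrank, hrank]
  have hsq : σ ^ 2 = 1 := hcard ▸ pow_card_eq_one'
  have hinv (x : K) : σ (σ x) = x := by
    have h := DFunLike.congr_fun hsq x
    rwa [pow_two] at h
  obtain ⟨x, hx⟩ : ∃ x, σ x ≠ x := by
    by_contra! h
    exact hσ (AlgEquiv.ext h)
  have hδ : x - σ x ≠ 0 := sub_ne_zero.mpr hx.symm
  have hΔ : a * (x - σ x) * σ 1 - σ (a * (x - σ x)) * 1 = x - σ x := by
    simp only [map_one, map_mul, map_sub, hinv]
    linear_combination (x - σ x) * ha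
  refine ⟨a * (x - σ x), 1, by rwa [hΔ], ?_⟩
  rw [hΔ, map_one, mul_one, mul_div_cancel_right₀ _ hδ]
end

section
/- Let (b₁,b₂) and (b₁′,b₂′) be pairs of elements of K with Δ(b₁,b₂) ≠ 0 and Δ(b₁′,b₂′) ≠ 0. If inv(b₁,b₂) = inv(b₁′,b₂′), then there exist nonzero t₁, t₂ ∈ F and nonzero c ∈ K such that b₁′ = t₁·c·b₁ and b₂′ = t₂·c·b₂ (the scalars t_i viewed in K via the embedding F → K). -/
/-- In a quadratic Galois extension, an element fixed by the nontrivial automorphism lies in the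
base field. -/
theorem mem_range_algebraMap_of_fixed {F K : Type*} [Field F] [Field K] [Algebra F K]
    [IsGalois F K] (hrank : Module.finrank F K = 2) {σ : K ≃ₐ[F] K} (hσ : σ ≠ AlgEquiv.refl)
    {x : K} (hx : σ x = x) : x ∈ Set.range (algebraMap F K) := by
  have : FiniteDimensional F K := Module.finite_of_finrank_pos (by omega)
  have hcard : Nat.card (K ≃ₐ[F] K) = 2 := (IsGalois.card_aut_eq_finrank F K).trans hrank
  obtain ⟨y, -, hy⟩ := (Nat.card_eq_two_iff' (AlgEquiv.refl : K ≃ₐ[F] K)).1 hcard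
  rw [IsGalois.mem_range_algebraMap_iff_fixed]
  intro f
  by_cases hf : f = AlgEquiv.refl
  · rw [hf, AlgEquiv.coe_refl, id]
  · rw [hy f hf, ← hy σ hσ, hx]

/-- For `K/F` a degree-2 Galois extension with nontrivial Galois element `σ`:
if two pairs `(b₁,b₂)` and `(b₁',b₂')` with nonvanishing `Δ` have the same invariant
`inv = b₁·σ(b₂)/Δ(b₁,b₂)`, then they differ by rescaling: `b₁' = t₁·c·b₁`,
`b₂' = t₂·c·b₂` for some nonzero `t₁ t₂ ∈ F` and nonzero `c ∈ K`. -/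
theorem inv_injective_up_to_rescaling
    {F K : Type*} [Field F] [Field K] [Algebra F K] [IsGalois F K]
    (hrank : Module.finrank F K = 2) (σ : K ≃ₐ[F] K) (hσ : σ ≠ AlgEquiv.refl)
    (b₁ b₂ b₁' b₂' : K)
    (hΔ : b₁ * σ b₂ - σ b₁ * b₂ ≠ 0) (hΔ' : b₁' * σ b₂' - σ b₁' * b₂' ≠ 0)
    (hinv : b₁ * σ b₂ / (b₁ * σ b₂ - σ b₁ * b₂)
          = b₁' * σ b₂' / (b₁' * σ b₂' - σ b₁' * b₂')) :
    ∃ t₁ t₂ : F, ∃ c : K, t₁ ≠ 0 ∧ t₂ ≠ 0 ∧ c ≠ 0 ∧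
      b₁' = algebraMap F K t₁ * c * b₁ ∧ b₂' = algebraMap F K t₂ * c * b₂ := by
  have h₁ : b₁ ≠ 0 := by rintro rfl; simp at hΔ
  have h₂ : b₂ ≠ 0 := by rintro rfl; simp at hΔ
  have h₁' : b₁' ≠ 0 := by rintro rfl; simp at hΔ'
  have h₂' : b₂' ≠ 0 := by rintro rfl; simp at hΔ'
  have hσ₁ : σ b₁ ≠ 0 := (map_ne_zero σ).2 h₁
  have hσ₂' : σ b₂' ≠ 0 := (map_ne_zero σ).2 h₂'
  have hfix : σ (b₁' * b₂ / (b₁ * b₂')) = b₁' * b₂ / (b₁ * b₂') := by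
    rw [div_eq_div_iff hΔ hΔ'] at hinv
    rw [map_div₀, map_mul, map_mul,
      div_eq_div_iff (mul_ne_zero hσ₁ hσ₂') (mul_ne_zero h₁ h₂')]
    linear_combination -hinv
  obtain ⟨t, ht⟩ := mem_range_algebraMap_of_fixed hrank hσ hfix
  refine ⟨t, 1, b₂' / b₂, ?_, one_ne_zero, div_ne_zero h₂' h₂, ?_, ?_⟩
  · rintro rfl
    rw [map_zero] at ht
    exact div_ne_zero (mul_ne_zero h₁' h₂) (mul_ne_zero h₁ h₂') ht.symm
  · rw [ht]
    field_simp
  · rw [map_one, one_mul, div_mul_cancel₀ _ h₂]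
end

section
/- Let P = {(b₁,b₂) ∈ K × K : Δ(b₁,b₂) ≠ 0}, and declare (b₁,b₂) ~ (b₁′,b₂′) when there exist nonzero t₁, t₂ ∈ F and nonzero c ∈ K with b₁′ = t₁·c·b₁ and b₂′ = t₂·c·b₂. Then the map inv : P → {a ∈ K : a + σ(a) = 1} is constant on ~-equivalence classes, and the induced map on the quotient P/~ is a bijection onto {a ∈ K : a + σ(a) = 1}. -/
/-- The rescaling equivalence on pairs: `(b₁,b₂) ~ (b₁',b₂')` iff there exist nonzero
`t₁ t₂ ∈ F` and nonzero `c ∈ K` with `b₁' = t₁·c·b₁` and `b₂' = t₂·c·b₂`. -/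
def pairRel (F : Type*) {K : Type*} [Field F] [Field K] [Algebra F K]
    (p q : K × K) : Prop :=
  ∃ t₁ t₂ : F, ∃ c : K, t₁ ≠ 0 ∧ t₂ ≠ 0 ∧ c ≠ 0 ∧
    q.1 = algebraMap F K t₁ * c * p.1 ∧ q.2 = algebraMap F K t₂ * c * p.2

/-- `Δ(b₁,b₂) = b₁·σ(b₂) − σ(b₁)·b₂`. -/
def pairDelta {F K : Type*} [Field F] [Field K] [Algebra F K]
    (σ : K ≃ₐ[F] K) (p : K × K) : K :=
  p.1 * σ p.2 - σ p.1 * p.2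

/-- `inv(b₁,b₂) = b₁·σ(b₂)/Δ(b₁,b₂)`. -/
def pairInv {F K : Type*} [Field F] [Field K] [Algebra F K]
    (σ : K ≃ₐ[F] K) (p : K × K) : K :=
  p.1 * σ p.2 / pairDelta σ p

section QuadraticGalois

variable {F K : Type*} [Field F] [Field K] [Algebra F K]

lemma AlgEquiv.apply_apply_of_finrank_eq_two [IsGalois F K]
    (hrank : Module.finrank F K = 2) (σ : K ≃ₐ[F] K) (x : K) : σ (σ x) = x := by
  have : FiniteDimensional F K := Module.finite_of_finrank_pos (by omega)
  have hcard : Nat.card (K ≃ₐ[F] K) = 2 := (IsGalois.card_aut_eq_finrank F K).trans hrank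
  have h : σ ^ 2 = 1 := hcard ▸ pow_card_eq_one'
  simpa [pow_two] using DFunLike.congr_fun h x

lemma AlgEquiv.exists_algebraMap_eq_of_finrank_eq_two [IsGalois F K]
    (hrank : Module.finrank F K = 2) {σ : K ≃ₐ[F] K} (hσ : σ ≠ AlgEquiv.refl)
    {x : K} (hx : σ x = x) : ∃ t : F, algebraMap F K t = x := by
  have : FiniteDimensional F K := Module.finite_of_finrank_pos (by omega)
  have hcard : Nat.card (K ≃ₐ[F] K) = 2 := (IsGalois.card_aut_eq_finrank F K).trans hrank
  obtain ⟨τ, -, hτ⟩ := (Nat.card_eq_two_iff' (1 : K ≃ₐ[F] K)).mp hcard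
  refine (IsGalois.mem_range_algebraMap_iff_fixed x).mpr fun g => ?_
  by_cases hg : g = 1
  · simp [hg]
  · rw [hτ g hg, ← hτ σ hσ, hx]

lemma fst_ne_zero_of_pairDelta_ne_zero {σ : K ≃ₐ[F] K} {p : K × K}
    (hp : pairDelta σ p ≠ 0) : p.1 ≠ 0 := by
  intro h
  simp [pairDelta, h] at hp

lemma snd_ne_zero_of_pairDelta_ne_zero {σ : K ≃ₐ[F] K} {p : K × K}
    (hp : pairDelta σ p ≠ 0) : p.2 ≠ 0 := by
  intro h
  simp [pairDelta, h] at hp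

lemma pairInv_eq_of_pairRel (σ : K ≃ₐ[F] K) {p q : K × K} (h : pairRel F p q) :
    pairInv σ p = pairInv σ q := by
  obtain ⟨t₁, t₂, c, ht₁, ht₂, hc, h₁, h₂⟩ := h
  set s := algebraMap F K t₁ * algebraMap F K t₂ * (c * σ c) with hs_def
  have hs : s ≠ 0 := by simp [hs_def, ht₁, ht₂, hc]
  have hnum : q.1 * σ q.2 = s * (p.1 * σ p.2) := by
    simp only [h₁, h₂, map_mul, AlgEquiv.commutes, hs_def]
    ring
  have hden : pairDelta σ q = s * pairDelta σ p := by
    simp only [pairDelta, h₁, h₂, map_mul, AlgEquiv.commutes, hs_def]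
    ring
  rw [pairInv, pairInv, hnum, hden, mul_div_mul_left _ _ hs]

lemma pairInv_add_apply_pairInv {σ : K ≃ₐ[F] K} (hinv : ∀ x, σ (σ x) = x) {p : K × K}
    (hp : pairDelta σ p ≠ 0) : pairInv σ p + σ (pairInv σ p) = 1 := by
  have h : σ (pairDelta σ p) = -pairDelta σ p := by
    simp only [pairDelta, map_sub, map_mul, hinv]
    ring
  rw [pairInv, map_div₀, h, div_neg, ← sub_eq_add_neg, ← sub_div, map_mul, hinv]
  exact div_self hp

lemma exists_pairInv_eq {σ : K ≃ₐ[F] K} (hinv : ∀ x, σ (σ x) = x)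
    (hσ : σ ≠ AlgEquiv.refl) {a : K} (ha : a + σ a = 1) :
    ∃ p : K × K, pairDelta σ p ≠ 0 ∧ pairInv σ p = a := by
  obtain ⟨x, hx⟩ : ∃ x, σ x ≠ x := by
    by_contra! h
    exact hσ (AlgEquiv.ext h)
  have hd : x - σ x ≠ 0 := sub_ne_zero.mpr hx.symm
  have h : pairDelta σ (a * (x - σ x), 1) = x - σ x := by
    simp only [pairDelta, map_mul, map_sub, map_one, hinv]
    linear_combination (x - σ x) * ha
  refine ⟨(a * (x - σ x), 1), by rwa [h], ?_⟩
  rw [pairInv, h, map_one, mul_one, mul_div_cancel_right₀ _ hd]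

lemma pairRel_of_pairInv_eq {σ : K ≃ₐ[F] K}
    (hfix : ∀ x, σ x = x → ∃ t : F, algebraMap F K t = x)
    {p q : K × K} (hp : pairDelta σ p ≠ 0) (hq : pairDelta σ q ≠ 0)
    (h : pairInv σ p = pairInv σ q) : pairRel F p q := by
  have hp₁ := fst_ne_zero_of_pairDelta_ne_zero hp
  have hp₂ := snd_ne_zero_of_pairDelta_ne_zero hp
  have hq₁ := fst_ne_zero_of_pairDelta_ne_zero hq
  have hq₂ := snd_ne_zero_of_pairDelta_ne_zero hq
  have hcross : p.1 * σ p.2 * (σ q.1 * q.2) = q.1 * σ q.2 * (σ p.1 * p.2) := by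
    rw [pairInv, pairInv, div_eq_div_iff hp hq, pairDelta, pairDelta] at h
    linear_combination -h
  obtain ⟨t, ht⟩ := hfix (q.1 * p.2 / (q.2 * p.1)) <| by
    rw [map_div₀, div_eq_div_iff (by simp [hq₂, hp₁]) (by simp [hq₂, hp₁]), map_mul, map_mul]
    linear_combination hcross
  refine ⟨t, 1, q.2 / p.2, ?_, one_ne_zero, div_ne_zero hq₂ hp₂, ?_, ?_⟩
  · rintro rfl
    rw [map_zero] at ht
    exact div_ne_zero (mul_ne_zero hq₁ hp₂) (mul_ne_zero hq₂ hp₁) ht.symm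
  · rw [ht]
    field_simp
  · rw [map_one]
    field_simp

end QuadraticGalois

/-- On the set `P = {(b₁,b₂) : Δ(b₁,b₂) ≠ 0}`, the invariant `inv` is constant on
equivalence classes of the rescaling relation `~`, and the induced map on `P/~` is a
bijection onto the set of trace-one elements `{a ∈ K : a + σ(a) = 1}`: it takes values
in that set, is surjective onto it, and two pairs with the same invariant are
`~`-equivalent. -/
theorem inv_bijection_on_quotient
    {F K : Type*} [Field F] [Field K] [Algebra F K] [IsGalois F K]
    (hrank : Module.finrank F K = 2) (σ : K ≃ₐ[F] K) (hσ : σ ≠ AlgEquiv.refl) :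
    (∀ p q : K × K, pairDelta σ p ≠ 0 → pairDelta σ q ≠ 0 →
        pairRel F p q → pairInv σ p = pairInv σ q) ∧
    (∀ p : K × K, pairDelta σ p ≠ 0 → pairInv σ p + σ (pairInv σ p) = 1) ∧
    (∀ a : K, a + σ a = 1 →
        ∃ p : K × K, pairDelta σ p ≠ 0 ∧ pairInv σ p = a) ∧
    (∀ p q : K × K, pairDelta σ p ≠ 0 → pairDelta σ q ≠ 0 →
        pairInv σ p = pairInv σ q → pairRel F p q) := by
  have hinv := AlgEquiv.apply_apply_of_finrank_eq_two hrank σ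
  exact ⟨fun _ _ _ _ h => pairInv_eq_of_pairRel σ h,
    fun _ hp => pairInv_add_apply_pairInv hinv hp,
    fun _ ha => exists_pairInv_eq hinv hσ ha,
    fun _ _ hp hq h => pairRel_of_pairInv_eq
      (fun _ hx => AlgEquiv.exists_algebraMap_eq_of_finrank_eq_two hrank hσ hx) hp hq h⟩
end

section
/- For every k ≤ n, the representation W_k of the hyperoctahedral group is irreducible: if U ⊆ W_k is a ℚ-submodule such that for every f ∈ U, every sign vector e ∈ X and every permutation τ of Fin n the functions x ↦ f(e * x) and x ↦ f(x ∘ τ) again lie in U, then U = 0 or U = W_k. -/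
/-- `χ_T(x) = ∏_{i ∈ T} x i`, the product of the `±1` coordinates in `T`, cast into `ℚ`. -/
def chi {n : ℕ} (T : Finset (Fin n)) : (Fin n → ℤˣ) → ℚ :=
  fun x => ∏ i ∈ T, ((x i : ℤ) : ℚ)

/-- `W n k` is the `ℚ`-span of the `χ_T` for `T ⊆ Fin n` with `|T| = k`. -/
def W (n k : ℕ) : Submodule ℚ ((Fin n → ℤˣ) → ℚ) :=
  Submodule.span ℚ (chi '' {T : Finset (Fin n) | T.card = k})

theorem chi_mul {n : ℕ} (T : Finset (Fin n)) (x y : Fin n → ℤˣ) :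
    chi T (x * y) = chi T x * chi T y := by
  simp [chi, Finset.prod_mul_distrib]

theorem chi_inv {n : ℕ} (T : Finset (Fin n)) (x : Fin n → ℤˣ) : chi T x⁻¹ = chi T x := by
  simp [chi]

theorem chi_comp_perm {n : ℕ} (T : Finset (Fin n)) (τ : Equiv.Perm (Fin n)) (x : Fin n → ℤˣ) :
    chi T (x ∘ τ) = chi (T.map τ.toEmbedding) x := by
  simp [chi]

/-- The convolution of any function with `χ_T` is a multiple of `χ_T`. -/
theorem sum_chi_mul_translate {n : ℕ} (T : Finset (Fin n)) (f : (Fin n → ℤˣ) → ℚ)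
    (x : Fin n → ℤˣ) :
    ∑ e, chi T e * f (e * x) = (∑ e, chi T e * f e) * chi T x := by
  rw [← Equiv.sum_comp (Equiv.mulRight x⁻¹), Finset.sum_mul]
  refine Finset.sum_congr rfl fun e _ => ?_
  simp only [Equiv.coe_mulRight, inv_mul_cancel_right, chi_mul, chi_inv]
  ring

theorem exists_perm_map_eq {α : Type*} [Finite α] {S T : Finset α} (h : T.card = S.card) :
    ∃ τ : Equiv.Perm α, T.map τ.toEmbedding = S := by
  classical
  let e : {x // x ∈ T} ≃ {x // x ∈ S} := Finset.equivOfCardEq h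
  refine ⟨e.extendSubtype, Finset.eq_of_subset_of_card_le (fun y hy => ?_) (by simp [h])⟩
  obtain ⟨x, hx, rfl⟩ := Finset.mem_map.1 hy
  exact e.extendSubtype_mem x hx

/-- A function in `W n k` orthogonal to every `χ_T` with `|T| = k` vanishes. -/
theorem eq_zero_of_mem_W {n k : ℕ} {f : (Fin n → ℤˣ) → ℚ} (hf : f ∈ W n k)
    (h : ∀ T : Finset (Fin n), T.card = k → ∑ e, chi T e * f e = 0) : f = 0 := by
  have key : ∀ g ∈ W n k, g ⬝ᵥ f = 0 := fun g hg => by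
    induction hg using Submodule.span_induction with
    | mem g hg =>
      obtain ⟨T, hT, rfl⟩ := hg
      exact h T hT
    | zero => exact zero_dotProduct f
    | add g₁ g₂ _ _ h₁ h₂ => rw [add_dotProduct, h₁, h₂, add_zero]
    | smul a g _ hg => rw [smul_dotProduct, hg, smul_zero]
  exact dotProduct_self_eq_zero.1 (key f hf)

/-- `W_k` is an irreducible representation of the hyperoctahedral group `{±1}ⁿ ⋊ Sₙ`:
any `ℚ`-submodule `U ≤ W_k` stable under all sign translations `x ↦ f(e * x)` and all
coordinate permutations `x ↦ f(x ∘ τ)` is `0` or all of `W_k`. -/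
theorem W_irreducible (n k : ℕ) (hk : k ≤ n)
    (U : Submodule ℚ ((Fin n → ℤˣ) → ℚ)) (hU : U ≤ W n k)
    (hstab : ∀ f ∈ U,
      (∀ e : Fin n → ℤˣ, (fun x => f (e * x)) ∈ U) ∧
      (∀ τ : Equiv.Perm (Fin n), (fun x => f (x ∘ τ)) ∈ U)) :
    U = ⊥ ∨ U = W n k := by
  refine or_iff_not_imp_left.2 fun hne => le_antisymm hU ?_
  obtain ⟨f, hfU, hf⟩ := (Submodule.ne_bot_iff U).1 hne
  obtain ⟨T, hT, hfT⟩ : ∃ T : Finset (Fin n), T.card = k ∧ ∑ e, chi T e * f e ≠ 0 := by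
    by_contra! h
    exact hf (eq_zero_of_mem_W (hU hfU) h)
  have hTU : chi T ∈ U := by
    have hsum : ∑ e, chi T e • (fun x => f (e * x)) ∈ U :=
      U.sum_mem fun e _ => U.smul_mem _ ((hstab f hfU).1 e)
    have heq : ∑ e, chi T e • (fun x => f (e * x)) = (∑ e, chi T e * f e) • chi T := by
      funext x
      simpa using sum_chi_mul_translate T f x
    exact (U.smul_mem_iff hfT).1 (heq ▸ hsum)
  refine Submodule.span_le.2 ?_
  rintro _ ⟨S, hS, rfl⟩
  obtain ⟨τ, rfl⟩ := exists_perm_map_eq (hT.trans (Eq.symm hS))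
  have h := (hstab _ hTU).2 τ
  simp only [chi_comp_perm] at h
  exact h
end
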